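/- Let N = 2, let q ∈ ℂ* be not a root of unity (or q = 1), and let ξ = diag(ξ₁, ξ₂). If ξ₁ − ξ₂, ξ₁ − q²ξ₂, …, ξ₁ − q^{2m−2}ξ₂ are all non-zero and ξ₁ − q^{2m}ξ₂ = 0, then the image of the co-orbit map β^ξ equals O(D\GL_q)^{≤m}, the span of products of length at most m in the generators x_{11}x_{21}/det_q, x_{12}x_{21}/det_q, x_{12}x_{22}/det_q of O(D\GL_q). In particular, the image of β^ξ is finite dimensional. -/

import Mathlib

open TensorProduct

noncomputable section

/-- Number of inversions (the length) of a permutation of `Fin t`. -/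
def invCount {t : ℕ} (σ : Equiv.Perm (Fin t)) : ℕ :=
  (Finset.univ.filter fun p : Fin t × Fin t => p.1 < p.2 ∧ σ p.2 < σ p.1).card

/-- The principal quantum minor `[I|I]` of the matrix of generators `x`. -/
def qMinor {A : Type} [CommRing A] {M : Type} [Ring M] [Algebra A M] {N : ℕ}
    (q : A) (x : Fin N → Fin N → M) (I : Finset (Fin N)) : M :=
  ∑ σ : Equiv.Perm (Fin I.card),
    ((-q) ^ invCount σ) •
      ((List.finRange I.card).map fun k =>
        x ((I.orderIsoOfFin rfl) k).1 ((I.orderIsoOfFin rfl) (σ k)).1).prod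

/-- The quantum determinant. -/
def qdet {A : Type} [CommRing A] {M : Type} [Ring M] [Algebra A M] {N : ℕ}
    (q : A) (x : Fin N → Fin N → M) : M :=
  qMinor q x Finset.univ

/-- `w(I)`: the sum of the elements of `I` (with `{1, …, N}` indexing). -/
def wtSet {N : ℕ} (I : Finset (Fin N)) : ℕ := ∑ j ∈ I, (j.1 + 1)

/-- The weighted sum `τ_i` of principal quantum minors of size `i`. -/
def tauCoinv {A : Type} [CommRing A] {M : Type} [Ring M] [Algebra A M] {N : ℕ}
    (q qinv : A) (x : Fin N → Fin N → M) (i : ℕ) : M :=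
  ∑ I ∈ Finset.univ.filter (fun I : Finset (Fin N) => I.card = i),
    qinv ^ (2 * wtSet I) • qMinor q x I

/-- The sum `σ_i` of all principal quantum minors of size `i`. -/
def sigmaCoinv {A : Type} [CommRing A] {M : Type} [Ring M] [Algebra A M] {N : ℕ}
    (q : A) (x : Fin N → Fin N → M) (i : ℕ) : M :=
  ∑ I ∈ Finset.univ.filter (fun I : Finset (Fin N) => I.card = i), qMinor q x I

/-- The right adjoint coaction `β(h) = Σ h₂ ⊗ S(h₁)h₃`. -/
def adjBeta {A : Type} [CommRing A] {M G : Type} [Ring M] [Algebra A M] [Ring G] [Algebra A G]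
    (ΔM : M →ₐ[A] M ⊗[A] M) (ι : M →ₐ[A] G) (St : G →ₗ[A] G) : M →ₗ[A] M ⊗[A] G :=
  TensorProduct.map LinearMap.id (LinearMap.mul' A G) ∘ₗ
  (TensorProduct.assoc A M G G).toLinearMap ∘ₗ
  TensorProduct.map
    ((TensorProduct.comm A G M).toLinearMap ∘ₗ
      TensorProduct.map (St ∘ₗ ι.toLinearMap) LinearMap.id)
    ι.toLinearMap ∘ₗ
  TensorProduct.map ΔM.toLinearMap LinearMap.id ∘ₗ ΔM.toLinearMap

/-- The right coaction `α(h) = Σ h₂ ⊗ h₃S(h₁)`. -/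
def adjAlpha {A : Type} [CommRing A] {M G : Type} [Ring M] [Algebra A M] [Ring G] [Algebra A G]
    (ΔM : M →ₐ[A] M ⊗[A] M) (ι : M →ₐ[A] G) (St : G →ₗ[A] G) : M →ₗ[A] M ⊗[A] G :=
  TensorProduct.map LinearMap.id (LinearMap.mul' A G) ∘ₗ
  TensorProduct.map LinearMap.id (TensorProduct.comm A G G).toLinearMap ∘ₗ
  (TensorProduct.assoc A M G G).toLinearMap ∘ₗ
  TensorProduct.map
    ((TensorProduct.comm A G M).toLinearMap ∘ₗ
      TensorProduct.map (St ∘ₗ ι.toLinearMap) LinearMap.id)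
    ι.toLinearMap ∘ₗ
  TensorProduct.map ΔM.toLinearMap LinearMap.id ∘ₗ ΔM.toLinearMap

/-- The co-orbit map associated to a point `e = ev_ξ` and a coaction `b`. -/
def coorbit {A : Type} [CommRing A] {M G : Type} [Ring M] [Algebra A M] [Ring G] [Algebra A G]
    (e : M →ₐ[A] A) (b : M →ₗ[A] M ⊗[A] G) : M →ₗ[A] G :=
  (TensorProduct.lid A G).toLinearMap ∘ₗ TensorProduct.map e.toLinearMap LinearMap.id ∘ₗ b

/-- The left coaction `λ_D = (π_D ⊗ id) ∘ Δ` of a quotient Hopf algebra. -/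
def leftCoact {A : Type} [CommRing A] {G D : Type} [Ring G] [Algebra A G]
    [CommRing D] [Algebra A D]
    (πD : G →ₐ[A] D) (ΔG : G →ₐ[A] G ⊗[A] G) : G →ₗ[A] D ⊗[A] G :=
  TensorProduct.map πD.toLinearMap LinearMap.id ∘ₗ ΔG.toLinearMap

/-- Coinvariants of the left coaction `λ_D`. -/
def dCoinv {A : Type} [CommRing A] {G D : Type} [Ring G] [Algebra A G]
    [CommRing D] [Algebra A D]
    (πD : G →ₐ[A] D) (ΔG : G →ₐ[A] G ⊗[A] G) : Set G :=
  {f : G | leftCoact πD ΔG f = (1 : D) ⊗ₜ[A] f}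

/-- The right coaction `ρ_D = (id ⊗ π_D) ∘ Δ`. -/
def rightCoact {A : Type} [CommRing A] {G D : Type} [Ring G] [Algebra A G]
    [CommRing D] [Algebra A D]
    (πD : G →ₐ[A] D) (ΔG : G →ₐ[A] G ⊗[A] G) : G →ₗ[A] G ⊗[A] D :=
  TensorProduct.map LinearMap.id πD.toLinearMap ∘ₗ ΔG.toLinearMap

/-- The weight space of weight `ta : D` for the grading induced by `ρ_D`. -/
def weightSpace' {A : Type} [CommRing A] {G D : Type} [Ring G] [Algebra A G]
    [CommRing D] [Algebra A D]
    (πD : G →ₐ[A] D) (ΔG : G →ₐ[A] G ⊗[A] G) (ta : D) : Submodule A G :=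
  LinearMap.ker (rightCoact πD ΔG - (TensorProduct.mk A G D).flip ta)

/-- The subcomodule generated by a subset `s` of the comodule `(M, b)`. -/
def comodGen {A : Type} [CommRing A] {M G : Type} [Ring M] [Algebra A M] [Ring G] [Algebra A G]
    (b : M →ₗ[A] M ⊗[A] G) (s : Set M) : Submodule A M :=
  sInf {W : Submodule A M | s ⊆ W ∧
    ∀ w ∈ W, b w ∈ LinearMap.range (TensorProduct.map W.subtype (LinearMap.id : G →ₗ[A] G))}


/-- Elements `a b c d u` of a `ℂ`-algebra satisfying the relations of the coordinate ring of
quantum `GL₂`, where `u` plays the role of the inverse of the quantum determinant. -/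
structure QuantumGL2 {R : Type*} [Ring R] [Algebra ℂ R] (q : ℂ) (a b c d u : R) : Prop where
  ne_zero : q ≠ 0
  ab : a * b = q • (b * a)
  ac : a * c = q • (c * a)
  cb : c * b = b * c
  db : d * b = q⁻¹ • (b * d)
  dc : d * c = q⁻¹ • (c * d)
  ua : u * a = a * u
  ub : u * b = b * u
  uc : u * c = c * u
  ud : u * d = d * u
  adu : a * (d * u) = 1 + q • (b * (c * u))
  dau : d * (a * u) = 1 + q⁻¹ • (b * (c * u))

section SkewCommute

variable {R : Type*} [Ring R] [Algebra ℂ R]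

lemma mul_pow_of_mul_eq_smul {x y : R} {r : ℂ} (h : x * y = r • (y * x)) (n : ℕ) :
    x * y ^ n = r ^ n • (y ^ n * x) := by
  induction n with
  | zero => simp
  | succ n ih =>
    rw [pow_succ y, ← mul_assoc, ih, smul_mul_assoc, mul_assoc, h, mul_smul_comm, smul_smul,
      mul_assoc, pow_succ]

lemma mul_monomial_of_mul_eq_smul {x y z : R} {r s : ℂ} (h : x * y = r • (y * x))
    (h' : x * z = s • (z * x)) (j i : ℕ) :
    x * (y ^ j * z ^ i) = (r ^ j * s ^ i) • (y ^ j * z ^ i * x) := by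
  rw [← mul_assoc, mul_pow_of_mul_eq_smul h, smul_mul_assoc, mul_assoc,
    mul_pow_of_mul_eq_smul h', mul_smul_comm, smul_smul, mul_assoc]

lemma mul_mul_of_mul_eq_smul {x y : R} {r : ℂ} (h : x * y = r • (y * x)) (z : R) :
    x * (y * z) = r • (y * (x * z)) := by
  rw [← mul_assoc, h, smul_mul_assoc, mul_assoc]

end SkewCommute

namespace QuantumGL2

variable {R : Type*} [Ring R] [Algebra ℂ R] {q : ℂ} {a b c d u : R}

lemma swap (h : QuantumGL2 q a b c d u) : QuantumGL2 q⁻¹ d c b a u where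
  ne_zero := inv_ne_zero h.ne_zero
  ab := h.dc
  ac := h.db
  cb := h.cb.symm
  db := by rw [inv_inv, h.ac]
  dc := by rw [inv_inv, h.ab]
  ua := h.ud
  ub := h.uc
  uc := h.ub
  ud := h.ua
  adu := by rw [h.dau, ← mul_assoc b, ← h.cb, mul_assoc]
  dau := by rw [h.adu, ← mul_assoc b, ← h.cb, mul_assoc, inv_inv]

lemma mul_left_cb (h : QuantumGL2 q a b c d u) (z : R) : c * (b * z) = b * (c * z) := by
  rw [← mul_assoc, h.cb, mul_assoc]

lemma mul_left_u (h : QuantumGL2 q a b c d u) (z : R) :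
    u * (a * z) = a * (u * z) ∧ u * (b * z) = b * (u * z) ∧ u * (c * z) = c * (u * z) ∧
      u * (d * z) = d * (u * z) := by
  simp only [← mul_assoc, h.ua, h.ub, h.uc, h.ud, and_self]

lemma mul_left_adu (h : QuantumGL2 q a b c d u) (z : R) :
    a * (d * (u * z)) = z + q • (b * (c * (u * z))) := by
  have := congrArg (· * z) h.adu
  simpa [mul_assoc, add_mul] using this

lemma mul_left_dau (h : QuantumGL2 q a b c d u) (z : R) :
    d * (a * (u * z)) = z + q⁻¹ • (b * (c * (u * z))) := by
  have := congrArg (· * z) h.dau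
  simpa [mul_assoc, add_mul] using this

lemma relations (h : QuantumGL2 q a b c d u) :
    a * (a * c * u) = q • (a * c * u * a) ∧ b * (a * c * u) = q⁻¹ • (a * c * u * b) ∧
    c * (a * c * u) = q⁻¹ • (a * c * u * c) ∧ a * (b * c * u) = q ^ 2 • (b * c * u * a) ∧
    b * (b * c * u) = (1 : ℂ) • (b * c * u * b) ∧ c * (b * c * u) = (1 : ℂ) • (b * c * u * c) ∧
    u * (a * c * u) = (1 : ℂ) • (a * c * u * u) ∧ u * (b * c * u) = (1 : ℂ) • (b * c * u * u) ∧
    a * c * u * (b * c * u) = q ^ 2 • (b * c * u * (a * c * u)) ∧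
    d * b * u * (b * c * u) = q⁻¹ ^ 2 • (b * c * u * (d * b * u)) ∧
    d * b * u * (a * c * u) = q⁻¹ • (b * c * u) + q⁻¹ ^ 2 • (b * c * u) ^ 2 ∧
    a * c * u * (d * b * u) = q • (b * c * u) + q ^ 2 • (b * c * u) ^ 2 := by
  have hq := h.ne_zero
  have hu := h.mul_left_u
  refine ⟨?_, ?_, ?_, ?_, ?_, ?_, ?_, ?_, ?_, ?_, ?_, ?_⟩ <;>
    simp only [sq, mul_assoc, h.ac, h.db, h.ua, h.ub, h.uc,
      mul_mul_of_mul_eq_smul h.ab, mul_mul_of_mul_eq_smul h.ac, mul_mul_of_mul_eq_smul h.db,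
      mul_mul_of_mul_eq_smul h.dc, h.mul_left_cb, (hu _).1, (hu _).2.1, (hu _).2.2.1,
      (hu _).2.2.2, h.mul_left_adu, h.mul_left_dau, smul_mul_assoc, mul_smul_comm,
      smul_smul, mul_add, one_mul] <;>
    match_scalars <;> field_simp


lemma bc_mul_ac (h : QuantumGL2 q a b c d u) :
    b * c * u * (a * c * u) = (q ^ 2)⁻¹ • (a * c * u * (b * c * u)) := by
  obtain ⟨-, -, -, -, -, -, -, -, hAB, -⟩ := h.relations
  rw [hAB, smul_smul, inv_mul_cancel₀ (pow_ne_zero _ h.ne_zero), one_smul]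

lemma commute_monomial (h : QuantumGL2 q a b c d u) (j i : ℕ) :
    a * ((a * c * u) ^ j * (b * c * u) ^ i) =
      (q ^ j * (q ^ 2) ^ i) • ((a * c * u) ^ j * (b * c * u) ^ i * a) ∧
    b * ((a * c * u) ^ j * (b * c * u) ^ i) =
      (q⁻¹ ^ j) • ((a * c * u) ^ j * (b * c * u) ^ i * b) ∧
    c * ((a * c * u) ^ j * (b * c * u) ^ i) =
      (q⁻¹ ^ j) • ((a * c * u) ^ j * (b * c * u) ^ i * c) ∧
    u * ((a * c * u) ^ j * (b * c * u) ^ i) = (a * c * u) ^ j * (b * c * u) ^ i * u ∧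
    b * c * u * ((a * c * u) ^ j * (b * c * u) ^ i) =
      ((q ^ 2)⁻¹ ^ j) • ((a * c * u) ^ j * (b * c * u) ^ (i + 1)) := by
  obtain ⟨haA, hbA, hcA, haB, hbB, hcB, huA, huB, -⟩ := h.relations
  refine ⟨mul_monomial_of_mul_eq_smul haA haB j i, ?_, ?_, ?_, ?_⟩
  · rw [mul_monomial_of_mul_eq_smul hbA hbB j i, one_pow, mul_one]
  · rw [mul_monomial_of_mul_eq_smul hcA hcB j i, one_pow, mul_one]
  · rw [mul_monomial_of_mul_eq_smul huA huB j i, one_pow, one_pow, one_mul, one_smul]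
  · have := mul_monomial_of_mul_eq_smul h.bc_mul_ac
      (one_smul ℂ (b * c * u * (b * c * u))).symm j i
    rwa [one_pow, mul_one, mul_assoc _ _ (b * c * u), ← pow_succ] at this

lemma mul_u_mul_mul {x y X : R} {r : ℂ} (hx : x * X = r • (X * x)) (hX : u * X = X * u)
    (hy : u * y = y * u) : x * u * X * y = r • (X * (x * y * u)) := by
  rw [mul_assoc x u, hX, ← mul_assoc x, hx, smul_mul_assoc, smul_mul_assoc]
  simp only [mul_assoc, hy]

lemma mul_u_mul_mul' {x y X : R} {r : ℂ} (hr : r ≠ 0) (hy' : y * X = r • (X * y))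
    (hy : u * y = y * u) : x * u * X * y = r⁻¹ • (x * y * u * X) := by
  have : X * y = r⁻¹ • (y * X) := by rw [hy', smul_smul, inv_mul_cancel₀ hr, one_smul]
  rw [mul_assoc _ X, this, mul_smul_comm]
  rw [mul_assoc x y u, ← hy]
  simp only [mul_assoc]

/-- The operator `g ↦ Σ ξ_k S(x_{1k}) g x_{k1}`. -/
def diagAct (q ξ1 ξ2 : ℂ) (a b c d u : R) : R →ₗ[ℂ] R :=
  ξ1 • LinearMap.mulLeftRight ℂ (d * u, a) - (q⁻¹ * ξ2) • LinearMap.mulLeftRight ℂ (b * u, c)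

/-- The operator `g ↦ Σ ξ_k S(x_{1k}) g x_{k2}`. -/
def offAct (q ξ1 ξ2 : ℂ) (b d u : R) : R →ₗ[ℂ] R :=
  ξ1 • LinearMap.mulLeftRight ℂ (d * u, b) - (q⁻¹ * ξ2) • LinearMap.mulLeftRight ℂ (b * u, d)

lemma offAct_swap_monomial (h : QuantumGL2 q a b c d u) (ξ1 ξ2 : ℂ) (j i : ℕ) :
    ∃ s : ℂ, s ≠ 0 ∧ offAct q⁻¹ ξ2 ξ1 c a u ((a * c * u) ^ j * (b * c * u) ^ i) =
      (s * (ξ1 - q ^ (2 * (j + i)) * ξ2)) • ((a * c * u) ^ (j + 1) * (b * c * u) ^ i) := by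
  have hq := h.ne_zero
  obtain ⟨ha, -, hc, hu, -⟩ := h.commute_monomial j i
  obtain ⟨-, -, -, -, -, -, -, -, hAB, -⟩ := h.relations
  refine ⟨-q⁻¹ ^ j * (q ^ 2)⁻¹ ^ i, by simp [hq], ?_⟩
  have hca : c * a * u = q⁻¹ • (a * c * u) := by
    rw [h.ac, smul_mul_assoc, smul_smul, inv_mul_cancel₀ hq, one_smul]
  rw [pow_succ _ j, mul_assoc _ (a * c * u), mul_pow_of_mul_eq_smul hAB, mul_smul_comm, ← mul_assoc]
  simp only [offAct, LinearMap.sub_apply, LinearMap.smul_apply, LinearMap.mulLeftRight_apply]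
  rw [mul_u_mul_mul ha hu h.uc, mul_u_mul_mul hc hu h.ua, hca, mul_smul_comm]
  match_scalars <;> simp only [inv_pow, mul_one] <;> field_simp <;> ring

lemma diagAct_swap_monomial (h : QuantumGL2 q a b c d u) (ξ1 ξ2 : ℂ) (j i : ℕ) :
    ∃ s t : ℂ, s ≠ 0 ∧ diagAct q⁻¹ ξ2 ξ1 d c b a u ((a * c * u) ^ j * (b * c * u) ^ i) =
      (s * (ξ1 - q ^ (2 * (j + i)) * ξ2)) • ((a * c * u) ^ j * (b * c * u) ^ (i + 1)) +
        t • ((a * c * u) ^ j * (b * c * u) ^ i) := by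
  have hq := h.ne_zero
  obtain ⟨ha, -, hc, hu, -⟩ := h.commute_monomial j i
  refine ⟨-q * q⁻¹ ^ j, ξ2 * (q ^ j * (q ^ 2) ^ i), by simp [hq], ?_⟩
  rw [pow_succ _ i, ← mul_assoc ((a * c * u) ^ j)]
  simp only [diagAct, LinearMap.sub_apply, LinearMap.smul_apply, LinearMap.mulLeftRight_apply]
  rw [mul_u_mul_mul ha hu h.ud, mul_u_mul_mul hc hu h.ub, h.cb, mul_assoc a d u, h.adu,
    ← mul_assoc b c u, mul_add, mul_smul_comm, mul_one]
  match_scalars <;> simp only [inv_pow, mul_one] <;> field_simp <;> ring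

lemma diagAct_monomial (h : QuantumGL2 q a b c d u) (ξ1 ξ2 : ℂ) (j i : ℕ) :
    ∃ s t : ℂ, diagAct q ξ1 ξ2 a b c d u ((a * c * u) ^ j * (b * c * u) ^ i) =
      (s * (ξ1 - q ^ (2 * (j + i)) * ξ2)) • ((a * c * u) ^ j * (b * c * u) ^ (i + 1)) +
        t • ((a * c * u) ^ j * (b * c * u) ^ i) := by
  have hq := h.ne_zero
  obtain ⟨ha, hb, -, hu, hB⟩ := h.commute_monomial j i
  refine ⟨q⁻¹ * q⁻¹ ^ (3 * j + 2 * i), ξ1 * (q ^ j * (q ^ 2) ^ i)⁻¹, ?_⟩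
  simp only [diagAct, LinearMap.sub_apply, LinearMap.smul_apply, LinearMap.mulLeftRight_apply]
  rw [mul_u_mul_mul' (by simp [hq]) ha h.ua, mul_u_mul_mul hb hu h.uc, mul_assoc d a u, h.dau,
    ← mul_assoc b c u, add_mul, one_mul, smul_mul_assoc, hB, pow_succ _ i,
    ← mul_assoc ((a * c * u) ^ j)]
  match_scalars <;> simp only [inv_pow, mul_one] <;> field_simp <;> ring

lemma offAct_pow (h : QuantumGL2 q a b c d u) (ξ1 ξ2 : ℂ) (i : ℕ) :
    ∃ s : ℂ, offAct q ξ1 ξ2 b d u ((b * c * u) ^ i) =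
      (s * (ξ1 - q ^ (2 * i) * ξ2)) • (d * b * u * (b * c * u) ^ i) := by
  have hq := h.ne_zero
  obtain ⟨-, hb, -, hu, -⟩ := h.commute_monomial 0 i
  obtain ⟨-, -, -, -, -, -, -, -, -, hCB, -⟩ := h.relations
  simp only [pow_zero, one_mul] at hb hu
  refine ⟨1, ?_⟩
  have hbd : b * d * u = q • (d * b * u) := by
    rw [h.db, smul_mul_assoc, smul_smul, mul_inv_cancel₀ hq, one_smul]
  simp only [offAct, LinearMap.sub_apply, LinearMap.smul_apply, LinearMap.mulLeftRight_apply]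
  rw [mul_u_mul_mul' one_ne_zero hb h.ub, mul_u_mul_mul hb hu h.ud, hbd,
    mul_pow_of_mul_eq_smul hCB, mul_smul_comm]
  match_scalars <;> simp only [inv_pow, mul_one] <;> field_simp <;> ring

lemma offAct_monomial (h : QuantumGL2 q a b c d u) (ξ1 ξ2 : ℂ) (j i : ℕ) :
    ∃ s t : ℂ, offAct q ξ1 ξ2 b d u ((a * c * u) ^ (j + 1) * (b * c * u) ^ i) =
      (s * (ξ1 - q ^ (2 * (j + 1 + i)) * ξ2)) • ((a * c * u) ^ j * (b * c * u) ^ (i + 2)) +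
        t • ((a * c * u) ^ j * (b * c * u) ^ (i + 1)) := by
  have hq := h.ne_zero
  obtain ⟨-, hb, -, hu, -⟩ := h.commute_monomial (j + 1) i
  obtain ⟨-, -, -, -, hB⟩ := h.commute_monomial j i
  obtain ⟨-, -, -, -, hB'⟩ := h.commute_monomial j (i + 1)
  obtain ⟨-, -, -, -, -, -, -, -, -, hCB, hCA, hAC⟩ := h.relations
  refine ⟨q⁻¹ * q⁻¹ ^ (3 * j), ξ1 * q ^ j * (q ^ 2)⁻¹ ^ j - ξ2 * q⁻¹ ^ j * (q ^ 2) ^ i, ?_⟩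
  have hbd : b * d * u = q • (d * b * u) := by
    rw [h.db, smul_mul_assoc, smul_smul, mul_inv_cancel₀ hq, one_smul]
  have hl : d * b * u * ((a * c * u) ^ (j + 1) * (b * c * u) ^ i) =
      q⁻¹ • (q ^ 2)⁻¹ ^ j • ((a * c * u) ^ j * (b * c * u) ^ (i + 1)) +
      q⁻¹ ^ 2 • (q ^ 2)⁻¹ ^ j • (q ^ 2)⁻¹ ^ j • ((a * c * u) ^ j * (b * c * u) ^ (i + 2)) := by
    rw [pow_succ' _ j, mul_assoc (a * c * u), ← mul_assoc (d * b * u), hCA, add_mul,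
      smul_mul_assoc, smul_mul_assoc, sq (b * c * u), mul_assoc (b * c * u), hB, mul_smul_comm,
      hB']
  have hr : (a * c * u) ^ (j + 1) * (b * c * u) ^ i * (d * b * u) =
      (q ^ 2) ^ i • (q • ((a * c * u) ^ j * (b * c * u) ^ (i + 1)) +
      q ^ 2 • ((a * c * u) ^ j * (b * c * u) ^ (i + 2))) := by
    have hBC : (b * c * u) ^ i * (d * b * u) = (q ^ 2) ^ i • (d * b * u * (b * c * u) ^ i) := by
      rw [mul_pow_of_mul_eq_smul hCB, smul_smul, ← mul_pow]
      simp [hq]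
    rw [mul_assoc, hBC, pow_succ _ j, mul_smul_comm, mul_assoc _ (a * c * u),
      ← mul_assoc (a * c * u) (d * b * u), hAC, add_mul, smul_mul_assoc, smul_mul_assoc,
      ← pow_succ', ← pow_add, add_comm 2 i, mul_add, mul_smul_comm, mul_smul_comm]
  simp only [offAct, LinearMap.sub_apply, LinearMap.smul_apply, LinearMap.mulLeftRight_apply]
  rw [mul_u_mul_mul' (by simp [hq]) hb h.ub, mul_u_mul_mul hb hu h.ud, hbd, mul_smul_comm, hl, hr]
  match_scalars <;> simp only [inv_pow, mul_one] <;> field_simp <;> ring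

/-- Stability under the operators attached to the four matrix coefficients. -/
def ActStable (q ξ1 ξ2 : ℂ) (a b c d u : R) (g : R) (W : Submodule ℂ R) : Prop :=
  diagAct q ξ1 ξ2 a b c d u g ∈ W ∧ offAct q ξ1 ξ2 b d u g ∈ W ∧
    offAct q⁻¹ ξ2 ξ1 c a u g ∈ W ∧ diagAct q⁻¹ ξ2 ξ1 d c b a u g ∈ W

lemma ActStable.swap {ξ1 ξ2 : ℂ} {g : R} {W : Submodule ℂ R}
    (hs : ActStable q ξ1 ξ2 a b c d u g W) : ActStable q⁻¹ ξ2 ξ1 d c b a u g W := by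
  obtain ⟨h1, h2, h3, h4⟩ := hs
  exact ⟨h4, h3, by rwa [inv_inv], by rwa [inv_inv]⟩

lemma actStable_monomial (h : QuantumGL2 q a b c d u) {ξ1 ξ2 : ℂ} {m : ℕ}
    (hz : ξ1 - q ^ (2 * m) * ξ2 = 0) {W : Submodule ℂ R}
    (hA : ∀ j i, j + i ≤ m → (a * c * u) ^ j * (b * c * u) ^ i ∈ W)
    (hC : ∀ i, 1 + i ≤ m → d * b * u * (b * c * u) ^ i ∈ W) {j i : ℕ} (hji : j + i ≤ m) :
    ActStable q ξ1 ξ2 a b c d u ((a * c * u) ^ j * (b * c * u) ^ i) W := by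
  have key : ∀ (n : ℕ) (s : ℂ) (y : R), n ≤ m → (n + 1 ≤ m → y ∈ W) →
      (s * (ξ1 - q ^ (2 * n) * ξ2)) • y ∈ W := by
    intro n s y hn hy
    rcases hn.lt_or_eq with hn | rfl
    · exact W.smul_mem _ (hy hn)
    · rw [hz, mul_zero, zero_smul]
      exact W.zero_mem
  refine ⟨?_, ?_, ?_, ?_⟩
  · obtain ⟨s, t, e⟩ := h.diagAct_monomial ξ1 ξ2 j i
    rw [e]
    exact W.add_mem (key _ _ _ hji fun _ => hA _ _ (by omega)) (W.smul_mem _ (hA _ _ hji))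
  · rcases j with _ | j
    · obtain ⟨s, e⟩ := h.offAct_pow ξ1 ξ2 i
      rw [pow_zero, one_mul, e]
      exact key _ _ _ (by omega) fun _ => hC _ (by omega)
    · obtain ⟨s, t, e⟩ := h.offAct_monomial ξ1 ξ2 j i
      rw [e]
      exact W.add_mem (key _ _ _ hji fun _ => hA _ _ (by omega))
        (W.smul_mem _ (hA _ _ (by omega)))
  · obtain ⟨s, -, e⟩ := h.offAct_swap_monomial ξ1 ξ2 j i
    rw [e]
    exact key _ _ _ hji fun _ => hA _ _ (by omega)
  · obtain ⟨s, t, -, e⟩ := h.diagAct_swap_monomial ξ1 ξ2 j i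
    rw [e]
    exact W.add_mem (key _ _ _ hji fun _ => hA _ _ (by omega)) (W.smul_mem _ (hA _ _ hji))

lemma monomial_mem_of_actStable (h : QuantumGL2 q a b c d u) {ξ1 ξ2 : ℂ} {m : ℕ}
    (hnz : ∀ k, k < m → ξ1 - q ^ (2 * k) * ξ2 ≠ 0) {W : Submodule ℂ R} (h1 : (1 : R) ∈ W)
    (hW : ∀ g ∈ W, ActStable q ξ1 ξ2 a b c d u g W) (j i : ℕ) (hji : j + i ≤ m) :
    (a * c * u) ^ j * (b * c * u) ^ i ∈ W := by
  induction i with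
  | zero =>
    induction j with
    | zero => simpa using h1
    | succ j ih =>
      obtain ⟨s, hs, e⟩ := h.offAct_swap_monomial ξ1 ξ2 j 0
      have := (hW _ (ih (by omega))).2.2.1
      rw [e] at this
      exact (W.smul_mem_iff (mul_ne_zero hs (hnz _ (by omega)))).1 this
  | succ i ih =>
    obtain ⟨s, t, hs, e⟩ := h.diagAct_swap_monomial ξ1 ξ2 j i
    have := (hW _ (ih (by omega))).2.2.2
    rw [e, W.add_mem_iff_left (W.smul_mem _ (ih (by omega)))] at this
    exact (W.smul_mem_iff (mul_ne_zero hs (hnz _ (by omega)))).1 this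


lemma generator_mul_monomial_mem (h : QuantumGL2 q a b c d u) {n : ℕ} {V : Submodule ℂ R}
    (hA : ∀ j i, j + i ≤ n + 1 → (a * c * u) ^ j * (b * c * u) ^ i ∈ V)
    (hC : ∀ i, 1 + i ≤ n + 1 → d * b * u * (b * c * u) ^ i ∈ V) {j i : ℕ} (hji : j + i ≤ n) :
    a * c * u * ((a * c * u) ^ j * (b * c * u) ^ i) ∈ V ∧
      b * c * u * ((a * c * u) ^ j * (b * c * u) ^ i) ∈ V ∧
      d * b * u * ((a * c * u) ^ j * (b * c * u) ^ i) ∈ V := by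
  obtain ⟨-, -, -, -, hB⟩ := h.commute_monomial j i
  refine ⟨?_, ?_, ?_⟩
  · rw [← mul_assoc, ← pow_succ']
    exact hA _ _ (by omega)
  · rw [hB]
    exact V.smul_mem _ (hA _ _ (by omega))
  · rcases j with _ | j
    · rw [pow_zero, one_mul]
      exact hC _ (by omega)
    · obtain ⟨-, -, -, -, -, -, -, -, -, -, hCA, -⟩ := h.relations
      obtain ⟨-, -, -, -, hB⟩ := h.commute_monomial j i
      obtain ⟨-, -, -, -, hB'⟩ := h.commute_monomial j (i + 1)
      rw [pow_succ' _ j, mul_assoc (a * c * u), ← mul_assoc (d * b * u), hCA, add_mul,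
        smul_mul_assoc, smul_mul_assoc, sq (b * c * u), mul_assoc (b * c * u), hB, mul_smul_comm,
        hB']
      exact V.add_mem (V.smul_mem _ (V.smul_mem _ (hA _ _ (by omega))))
        (V.smul_mem _ (V.smul_mem _ (V.smul_mem _ (hA _ _ (by omega)))))

/-- The span of the ordered monomials of degree at most `m`. -/
def monomialSpan (a b c d u : R) (m : ℕ) : Submodule ℂ R :=
  Submodule.span ℂ {g | ∃ j i, j + i ≤ m ∧ (g = (a * c * u) ^ j * (b * c * u) ^ i ∨
    g = (d * b * u) ^ j * (b * c * u) ^ i)}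

lemma monomial_mem_monomialSpan {m j i : ℕ} (hji : j + i ≤ m) :
    (a * c * u) ^ j * (b * c * u) ^ i ∈ monomialSpan a b c d u m ∧
      (d * b * u) ^ j * (b * c * u) ^ i ∈ monomialSpan a b c d u m :=
  ⟨Submodule.subset_span ⟨j, i, hji, .inl rfl⟩, Submodule.subset_span ⟨j, i, hji, .inr rfl⟩⟩

lemma one_mem_monomialSpan (m : ℕ) : (1 : R) ∈ monomialSpan a b c d u m := by
  simpa using (monomial_mem_monomialSpan (a := a) (b := b) (c := c) (d := d) (u := u)
    (j := 0) (i := 0) (Nat.zero_le m)).1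

lemma monomialSpan_mono {m n : ℕ} (hmn : m ≤ n) :
    monomialSpan a b c d u m ≤ monomialSpan a b c d u n :=
  Submodule.span_mono fun _ ⟨j, i, hji, e⟩ => ⟨j, i, hji.trans hmn, e⟩

instance finiteDimensional_monomialSpan (m : ℕ) :
    FiniteDimensional ℂ (monomialSpan a b c d u m) := by
  refine FiniteDimensional.span_of_finite ℂ (Set.Finite.subset
    (((Set.finite_Iic m).prod (Set.finite_Iic m)).image
      (fun p : ℕ × ℕ => (a * c * u) ^ p.1 * (b * c * u) ^ p.2) |>.union
    (((Set.finite_Iic m).prod (Set.finite_Iic m)).image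
      (fun p : ℕ × ℕ => (d * b * u) ^ p.1 * (b * c * u) ^ p.2))) ?_)
  rintro g ⟨j, i, hji, rfl | rfl⟩
  · exact .inl ⟨(j, i), ⟨Set.mem_Iic.2 (by omega), Set.mem_Iic.2 (by omega)⟩, rfl⟩
  · exact .inr ⟨(j, i), ⟨Set.mem_Iic.2 (by omega), Set.mem_Iic.2 (by omega)⟩, rfl⟩

lemma generator_mul_mem_monomialSpan (h : QuantumGL2 q a b c d u) {n : ℕ} {g : R}
    (hg : g ∈ monomialSpan a b c d u n) :
    a * c * u * g ∈ monomialSpan a b c d u (n + 1) ∧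
      b * c * u * g ∈ monomialSpan a b c d u (n + 1) ∧
      b * d * u * g ∈ monomialSpan a b c d u (n + 1) := by
  have hbd : b * d * u = q • (d * b * u) := by
    rw [h.db, smul_mul_assoc, smul_smul, mul_inv_cancel₀ h.ne_zero, one_smul]
  rw [hbd, smul_mul_assoc]
  have key : ∀ y : R, (∀ j i, j + i ≤ n →
      y * ((a * c * u) ^ j * (b * c * u) ^ i) ∈ monomialSpan a b c d u (n + 1) ∧
      y * ((d * b * u) ^ j * (b * c * u) ^ i) ∈ monomialSpan a b c d u (n + 1)) →
      y * g ∈ monomialSpan a b c d u (n + 1) := by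
    intro y hy
    induction hg using Submodule.span_induction with
    | mem x hx =>
      obtain ⟨j, i, hji, rfl | rfl⟩ := hx
      exacts [(hy j i hji).1, (hy j i hji).2]
    | zero => rw [mul_zero]; exact Submodule.zero_mem _
    | add x y _ _ hx hy => rw [mul_add]; exact Submodule.add_mem _ hx hy
    | smul r x _ hx => rw [mul_smul_comm]; exact Submodule.smul_mem _ _ hx
  have hA := fun j i (hji : j + i ≤ n) => h.generator_mul_monomial_mem
    (V := monomialSpan a b c d u (n + 1)) (fun j i hji => (monomial_mem_monomialSpan hji).1)
    (fun i hi => by simpa using (monomial_mem_monomialSpan (j := 1) hi).2) hji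
  have hC := fun j i (hji : j + i ≤ n) => h.swap.generator_mul_monomial_mem
    (V := monomialSpan a b c d u (n + 1))
    (fun j i hji => by rw [h.cb]; exact (monomial_mem_monomialSpan hji).2)
    (fun i hi => by rw [h.cb]; simpa using (monomial_mem_monomialSpan (j := 1) hi).1) hji
  rw [h.cb] at hC
  exact ⟨key _ fun j i hji => ⟨(hA j i hji).1, (hC j i hji).2.2⟩,
    key _ fun j i hji => ⟨(hA j i hji).2.1, (hC j i hji).2.1⟩,
    Submodule.smul_mem _ _ (key _ fun j i hji => ⟨(hA j i hji).2.2, (hC j i hji).1⟩)⟩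

lemma monomialSpan_eq_span_prod (h : QuantumGL2 q a b c d u) (m : ℕ) :
    monomialSpan a b c d u m = Submodule.span ℂ {y : R | ∃ l : List R,
      (∀ z ∈ l, z = a * c * u ∨ z = b * c * u ∨ z = b * d * u) ∧ l.length ≤ m ∧ y = l.prod} := by
  have hdb : d * b * u = q⁻¹ • (b * d * u) := by rw [h.db, smul_mul_assoc]
  apply le_antisymm
  · rw [monomialSpan, Submodule.span_le]
    rintro g ⟨j, i, hji, rfl | rfl⟩
    · refine Submodule.subset_span
        ⟨List.replicate j (a * c * u) ++ List.replicate i (b * c * u), ?_, by simpa, by simp⟩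
      intro z hz
      rcases List.mem_append.1 hz with hz | hz
      · exact .inl (List.eq_of_mem_replicate hz)
      · exact .inr (.inl (List.eq_of_mem_replicate hz))
    · rw [hdb, smul_pow, smul_mul_assoc]
      refine Submodule.smul_mem _ _ (Submodule.subset_span
        ⟨List.replicate j (b * d * u) ++ List.replicate i (b * c * u), ?_, by simpa, by simp⟩)
      intro z hz
      rcases List.mem_append.1 hz with hz | hz
      · exact .inr (.inr (List.eq_of_mem_replicate hz))
      · exact .inr (.inl (List.eq_of_mem_replicate hz))
  · rw [Submodule.span_le]
    rintro y ⟨l, hl, hlen, rfl⟩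
    refine monomialSpan_mono hlen ?_
    clear hlen
    induction l with
    | nil => exact one_mem_monomialSpan _
    | cons z l ih =>
      have hg := h.generator_mul_mem_monomialSpan (ih fun z hz => hl z (List.mem_cons_of_mem _ hz))
      rw [List.prod_cons, List.length_cons]
      rcases hl z List.mem_cons_self with rfl | rfl | rfl
      exacts [hg.1, hg.2.1, hg.2.2]

lemma actStable_monomialSpan (h : QuantumGL2 q a b c d u) {ξ1 ξ2 : ℂ} {m : ℕ}
    (hz : ξ1 - q ^ (2 * m) * ξ2 = 0) {g : R} (hg : g ∈ monomialSpan a b c d u m) :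
    ActStable q ξ1 ξ2 a b c d u g (monomialSpan a b c d u m) := by
  have hz' : ξ2 - q⁻¹ ^ (2 * m) * ξ1 = 0 := by
    rw [sub_eq_zero.1 hz, inv_pow, inv_mul_cancel_left₀ (pow_ne_zero _ h.ne_zero), sub_self]
  induction hg using Submodule.span_induction with
  | mem x hx =>
    obtain ⟨j, i, hji, rfl | rfl⟩ := hx
    · exact h.actStable_monomial hz (fun j i hji => (monomial_mem_monomialSpan hji).1)
        (fun i hi => by simpa using (monomial_mem_monomialSpan (j := 1) hi).2) hji
    · have := h.swap.actStable_monomial hz' (W := monomialSpan a b c d u m)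
        (fun j i hji => by rw [h.cb]; exact (monomial_mem_monomialSpan hji).2)
        (fun i hi => by rw [h.cb]; simpa using (monomial_mem_monomialSpan (j := 1) hi).1) hji
      rw [h.cb] at this
      simpa using this.swap
  | zero => simp [ActStable]
  | add x y _ _ hx hy =>
    simp only [ActStable, map_add] at hx hy ⊢
    exact ⟨add_mem hx.1 hy.1, add_mem hx.2.1 hy.2.1, add_mem hx.2.2.1 hy.2.2.1,
      add_mem hx.2.2.2 hy.2.2.2⟩
  | smul r x _ hx =>
    simp only [ActStable, map_smul] at hx ⊢
    exact ⟨Submodule.smul_mem _ _ hx.1, Submodule.smul_mem _ _ hx.2.1,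
      Submodule.smul_mem _ _ hx.2.2.1, Submodule.smul_mem _ _ hx.2.2.2⟩

lemma monomialSpan_le_of_actStable (h : QuantumGL2 q a b c d u) {ξ1 ξ2 : ℂ} {m : ℕ}
    (hnz : ∀ k, k < m → ξ1 - q ^ (2 * k) * ξ2 ≠ 0) {W : Submodule ℂ R} (h1 : (1 : R) ∈ W)
    (hW : ∀ g ∈ W, ActStable q ξ1 ξ2 a b c d u g W) : monomialSpan a b c d u m ≤ W := by
  have hnz' : ∀ k, k < m → ξ2 - q⁻¹ ^ (2 * k) * ξ1 ≠ 0 := by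
    intro k hk h0
    apply hnz k hk
    rw [sub_eq_zero.1 h0, inv_pow, mul_inv_cancel_left₀ (pow_ne_zero _ h.ne_zero), sub_self]
  rw [monomialSpan, Submodule.span_le]
  rintro g ⟨j, i, hji, rfl | rfl⟩
  · exact h.monomial_mem_of_actStable hnz h1 hW j i hji
  · have := h.swap.monomial_mem_of_actStable hnz' h1 (fun g hg => (hW g hg).swap) j i hji
    rwa [h.cb] at this

end QuantumGL2

lemma QuantumGL2.of_mul_qdet {R : Type*} [Ring R] [Algebra ℂ R] {q : ℂ} {a b c d u : R}
    (hq : q ≠ 0) (hab : a * b = q • (b * a)) (hac : a * c = q • (c * a)) (hbc : b * c = c * b)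
    (hbd : b * d = q • (d * b)) (hcd : c * d = q • (d * c))
    (had : a * d - d * a = (q - q⁻¹) • (b * c)) (hu : (a * d - q • (b * c)) * u = 1)
    (hu' : u * (a * d - q • (b * c)) = 1) : QuantumGL2 q a b c d u := by
  have hdb : d * b = q⁻¹ • (b * d) := by rw [hbd, smul_smul, inv_mul_cancel₀ hq, one_smul]
  have hdc : d * c = q⁻¹ • (c * d) := by rw [hcd, smul_smul, inv_mul_cancel₀ hq, one_smul]
  have hda : d * a = a * d - (q - q⁻¹) • (b * c) := by rw [← had]; abel
  have hcb (z : R) : c * (b * z) = b * (c * z) := by rw [← mul_assoc, ← hbc, mul_assoc]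
  have hdaz (z : R) : d * (a * z) = a * (d * z) - (q - q⁻¹) • (b * (c * z)) := by
    rw [← mul_assoc, hda, sub_mul, smul_mul_assoc, mul_assoc, mul_assoc]
  have hcomm : ∀ y : R, y * (a * d - q • (b * c)) = (a * d - q • (b * c)) * y →
      u * y = y * u := fun y hy => by
    calc u * y = u * (y * (a * d - q • (b * c))) * u := by rw [mul_assoc, mul_assoc, hu, mul_one]
      _ = y * u := by rw [hy, ← mul_assoc, hu', one_mul]
  have hbcu : b * (c * u) = b * c * u := (mul_assoc _ _ _).symm
  have had1 : a * (d * u) = 1 + q • (b * (c * u)) := by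
    rw [← hu, sub_mul, smul_mul_assoc, mul_assoc, mul_assoc]
    abel
  refine ⟨hq, hab, hac, hbc.symm, hdb, hdc, hcomm _ ?_, hcomm _ ?_, hcomm _ ?_, hcomm _ ?_,
    had1, ?_⟩
  case refine_5 =>
    rw [hdaz, had1]
    module
  all_goals
    simp only [mul_sub, sub_mul, mul_assoc, hac, ← hbc, hdb, hdc, hda, hcb, hdaz,
      mul_mul_of_mul_eq_smul hab, mul_mul_of_mul_eq_smul hac, mul_mul_of_mul_eq_smul hdb,
      smul_mul_assoc, mul_smul_comm, smul_smul]
    match_scalars <;> field_simp <;> ring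

lemma qdet_fin_two {M : Type} [Ring M] [Algebra ℂ M] (q : ℂ) (x : Fin 2 → Fin 2 → M) :
    qdet q x = x 0 0 * x 1 1 - q • (x 0 1 * x 1 0) := by
  have hid : (fun k : Fin 2 => (((Finset.univ : Finset (Fin 2)).orderIsoOfFin rfl) k).1) = id :=
    (Finset.orderEmbOfFin_unique (k := 2) rfl (fun _ => Finset.mem_univ _) strictMono_id).symm
  have huniv : (Finset.univ : Finset (Equiv.Perm (Fin 2))) = {1, Equiv.swap 0 1} := by decide
  have e1 : invCount (1 : Equiv.Perm (Fin 2)) = 0 := by decide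
  have e2 : invCount (Equiv.swap 0 1 : Equiv.Perm (Fin 2)) = 1 := by decide
  change ∑ σ : Equiv.Perm (Fin 2), ((-q) ^ invCount σ) •
      ((List.finRange 2).map fun k =>
        x ((fun k : Fin 2 => (((Finset.univ : Finset (Fin 2)).orderIsoOfFin rfl) k).1) k)
          ((fun k : Fin 2 => (((Finset.univ : Finset (Fin 2)).orderIsoOfFin rfl) k).1)
            (σ k))).prod = _
  rw [hid, huniv, Finset.sum_pair (by decide), e1, e2]
  simp [List.finRange_succ, sub_eq_add_neg]

section Antipode

variable {A M G : Type} [CommRing A] [Ring M] [Algebra A M] [Ring G] [Algebra A G]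

/-- The antipode of a bialgebra, given by bare structure maps, reverses products. -/
lemma antipode_mul_of_convolution_inverse (ΔG : G →ₐ[A] G ⊗[A] G) (εG : G →ₐ[A] A) (St : G →ₗ[A] G)
    (hcoassoc : (Algebra.TensorProduct.assoc A A A G G G).toAlgHom.comp
      ((Algebra.TensorProduct.map ΔG (.id A G)).comp ΔG)
      = (Algebra.TensorProduct.map (.id A G) ΔG).comp ΔG)
    (hl : (Algebra.TensorProduct.map εG (.id A G)).comp ΔG = (Algebra.TensorProduct.lid A G).symm)
    (hr : (Algebra.TensorProduct.map (.id A G) εG).comp ΔG = (Algebra.TensorProduct.rid A A G).symm)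
    (hS1 : LinearMap.mul' A G ∘ₗ TensorProduct.map St LinearMap.id ∘ₗ ΔG.toLinearMap
      = Algebra.linearMap A G ∘ₗ εG.toLinearMap)
    (hS2 : LinearMap.mul' A G ∘ₗ TensorProduct.map LinearMap.id St ∘ₗ ΔG.toLinearMap
      = Algebra.linearMap A G ∘ₗ εG.toLinearMap) (g h : G) :
    St (g * h) = St h * St g := by
  let _ : Bialgebra A G := Bialgebra.ofAlgHom ΔG εG hcoassoc hl hr
  let _ : HopfAlgebra A G :=
    { antipode := St
      mul_antipode_rTensor_comul := hS1
      mul_antipode_lTensor_comul := hS2 }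
  exact HopfAlgebra.antipode_mul_antidistrib g h

/-- `m₁ ⊗ m₂ ⊗ m₃ ↦ e(m₂) S(m₁) m₃`. -/
def evalMiddle (ι : M →ₐ[A] G) (St : G →ₗ[A] G) (e : M →ₐ[A] A) : (M ⊗[A] M) ⊗[A] M →ₗ[A] G :=
  (TensorProduct.lid A G).toLinearMap ∘ₗ TensorProduct.map e.toLinearMap LinearMap.id ∘ₗ
  TensorProduct.map LinearMap.id (LinearMap.mul' A G) ∘ₗ
  (TensorProduct.assoc A M G G).toLinearMap ∘ₗ
  TensorProduct.map
    ((TensorProduct.comm A G M).toLinearMap ∘ₗ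
      TensorProduct.map (St ∘ₗ ι.toLinearMap) LinearMap.id)
    ι.toLinearMap

lemma evalMiddle_tmul (ι : M →ₐ[A] G) (St : G →ₗ[A] G) (e : M →ₐ[A] A) (m₁ m₂ m₃ : M) :
    evalMiddle ι St e (m₁ ⊗ₜ m₂ ⊗ₜ m₃) = e m₂ • (St (ι m₁) * ι m₃) := by
  simp [evalMiddle]

lemma coorbit_adjBeta_apply (ΔM : M →ₐ[A] M ⊗[A] M) (ι : M →ₐ[A] G) (St : G →ₗ[A] G)
    (e : M →ₐ[A] A) (h : M) :
    coorbit e (adjBeta ΔM ι St) h =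
      evalMiddle ι St e (Algebra.TensorProduct.map ΔM (.id A M) (ΔM h)) := rfl

lemma evalMiddle_mul_tmul {ι : M →ₐ[A] G} {St : G →ₗ[A] G}
    (hSt : ∀ g h, St (g * h) = St h * St g) (e : M →ₐ[A] A) (z : (M ⊗[A] M) ⊗[A] M)
    (k₁ k₂ k₃ : M) :
    evalMiddle ι St e (z * (k₁ ⊗ₜ k₂ ⊗ₜ k₃)) =
      e k₂ • (St (ι k₁) * evalMiddle ι St e z * ι k₃) := by
  induction z with
  | zero => simp
  | add x y hx hy => rw [add_mul, map_add, hx, hy, map_add, mul_add, add_mul, smul_add]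
  | tmul w m₃ =>
    induction w with
    | zero => simp
    | add x y hx hy =>
      rw [TensorProduct.add_tmul, add_mul, map_add, hx, hy, map_add, mul_add, add_mul, smul_add]
    | tmul m₁ m₂ =>
      simp only [Algebra.TensorProduct.tmul_mul_tmul, evalMiddle_tmul, map_mul, hSt,
        mul_smul_comm, smul_mul_assoc, smul_smul, mul_assoc, mul_comm (e k₂)]

lemma coorbit_adjBeta_one {ΔM : M →ₐ[A] M ⊗[A] M} {ι : M →ₐ[A] G} {St : G →ₗ[A] G}
    (hSt1 : St 1 = 1) (e : M →ₐ[A] A) : coorbit e (adjBeta ΔM ι St) 1 = 1 := by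
  rw [coorbit_adjBeta_apply, map_one, map_one, Algebra.TensorProduct.one_def,
    Algebra.TensorProduct.one_def, evalMiddle_tmul]
  simp [hSt1]

lemma coorbit_adjBeta_mul {N : ℕ} {x : Fin N → Fin N → M} {ΔM : M →ₐ[A] M ⊗[A] M}
    (hΔM : ∀ i j, ΔM (x i j) = ∑ k, x i k ⊗ₜ[A] x k j) {ι : M →ₐ[A] G} {St : G →ₗ[A] G}
    (hSt : ∀ g h, St (g * h) = St h * St g) (e : M →ₐ[A] A) (h : M) (i j : Fin N) :
    coorbit e (adjBeta ΔM ι St) (h * x i j) = ∑ k, ∑ l,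
      e (x l k) • (St (ι (x i l)) * coorbit e (adjBeta ΔM ι St) h * ι (x k j)) := by
  simp only [coorbit_adjBeta_apply, map_mul, hΔM, map_sum, Algebra.TensorProduct.map_tmul,
    AlgHom.id_apply, TensorProduct.sum_tmul, Finset.mul_sum, evalMiddle_mul_tmul hSt]

lemma range_le_of_mul_closed {W : Submodule A G} {X : Set M} (hX : Algebra.adjoin A X = ⊤)
    (f : M →ₗ[A] G) (h1 : f 1 ∈ W) (hmul : ∀ h, f h ∈ W → ∀ y ∈ X, f (h * y) ∈ W) :
    LinearMap.range f ≤ W := by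
  have key : ∀ y ∈ Algebra.adjoin A X, ∀ h, f h ∈ W → f (h * y) ∈ W := by
    intro y hy
    induction hy using Algebra.adjoin_induction with
    | mem y hy => exact fun h hh => hmul h hh y hy
    | algebraMap r =>
      intro h hh
      rw [← Algebra.commutes, ← Algebra.smul_def, map_smul]
      exact W.smul_mem r hh
    | add y z _ _ hy hz =>
      intro h hh
      rw [mul_add, map_add]
      exact W.add_mem (hy h hh) (hz h hh)
    | mul y z _ _ hy hz =>
      intro h hh
      rw [← mul_assoc]
      exact hz _ (hy h hh)
  rintro _ ⟨y, rfl⟩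
  simpa using key y (hX ▸ Algebra.mem_top) 1 h1

end Antipode
/-- `N = 2`, `q` not a root of unity, `ξ = diag(ξ₁, ξ₂)` with
`ξ₁ - q^(2k) ξ₂ ≠ 0` for `k < m` and `ξ₁ - q^(2m) ξ₂ = 0`: the image of `β^ξ` is
`O(D\GL_q)^{≤m}`; in particular it is finite dimensional. -/
theorem image_coorbit_beta_2x2_degenerate
    (q : ℂ) (hq : q ≠ 0) (hqru : (∀ n : ℕ, 0 < n → q ^ n ≠ 1) ∨ q = 1)
    (M G : Type) [Ring M] [Algebra ℂ M] [Ring G] [Algebra ℂ G]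
    (x : Fin 2 → Fin 2 → M)
    (hrow : ∀ i j l : Fin 2, j < l → x i j * x i l = (q) • (x i l * x i j))
    (hcol : ∀ i k j : Fin 2, i < k → x i j * x k j = (q) • (x k j * x i j))
    (hanti : ∀ i k j l : Fin 2, i < k → j < l → x i l * x k j = x k j * x i l)
    (hdiag : ∀ i k j l : Fin 2, i < k → j < l →
      x i j * x k l - x k l * x i j = ((q) - (q⁻¹)) • (x i l * x k j))
    (hgen : Algebra.adjoin ℂ (Set.range fun p : Fin 2 × Fin 2 => x p.1 p.2) = ⊤)
    (hfree : ∀ (B : Type) [Ring B] [Algebra ℂ B] (y : Fin 2 → Fin 2 → B),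
      (∀ i j l : Fin 2, j < l → y i j * y i l = (q) • (y i l * y i j)) →
      (∀ i k j : Fin 2, i < k → y i j * y k j = (q) • (y k j * y i j)) →
      (∀ i k j l : Fin 2, i < k → j < l → y i l * y k j = y k j * y i l) →
      (∀ i k j l : Fin 2, i < k → j < l →
        y i j * y k l - y k l * y i j = ((q) - (q⁻¹)) • (y i l * y k j)) →
      ∃! φ : M →ₐ[ℂ] B, ∀ i j, φ (x i j) = y i j)
    (ι : M →ₐ[ℂ] G) (dInv : G)
    (hd1 : ι (qdet (q) x) * dInv = 1)
    (hd2 : dInv * ι (qdet (q) x) = 1)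
    (hgenG : Algebra.adjoin ℂ
      (Set.range (fun p : Fin 2 × Fin 2 => ι (x p.1 p.2)) ∪ {dInv}) = ⊤)
    (hfreeG : ∀ (B : Type) [Ring B] [Algebra ℂ B] (φ : M →ₐ[ℂ] B) (u : B),
      φ (qdet (q) x) * u = 1 → u * φ (qdet (q) x) = 1 →
      ∃! ψ : G →ₐ[ℂ] B, ψ.comp ι = φ)
    (ΔM : M →ₐ[ℂ] M ⊗[ℂ] M)
    (hΔM : ∀ i j, ΔM (x i j) = ∑ k, x i k ⊗ₜ[ℂ] x k j)
    (ΔG : G →ₐ[ℂ] G ⊗[ℂ] G)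
    (hΔG : ∀ m, ΔG (ι m) = Algebra.TensorProduct.map ι ι (ΔM m))
    (εG : G →ₐ[ℂ] ℂ)
    (hεG : ∀ i j, εG (ι (x i j)) = if i = j then 1 else 0)
    (St : G →ₗ[ℂ] G)
    (hS1 : LinearMap.mul' ℂ G ∘ₗ TensorProduct.map St LinearMap.id ∘ₗ ΔG.toLinearMap
      = Algebra.linearMap ℂ G ∘ₗ εG.toLinearMap)
    (hS2 : LinearMap.mul' ℂ G ∘ₗ TensorProduct.map LinearMap.id St ∘ₗ ΔG.toLinearMap
      = Algebra.linearMap ℂ G ∘ₗ εG.toLinearMap)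
    (D : Type) [CommRing D] [Algebra ℂ D]
    (t : Fin 2 → (D)ˣ)
    (πD : G →ₐ[ℂ] D)
    (hπD : ∀ i j, πD (ι (x i j)) = if i = j then (t i : D) else 0)
    (hfreeD : ∀ (B : Type) [CommRing B] [Algebra ℂ B] (u : Fin 2 → Bˣ),
      ∃! φ : D →ₐ[ℂ] B, ∀ i, φ (t i : D) = (u i : B))
    (ξ1 ξ2 : ℂ) (e : M →ₐ[ℂ] ℂ)
    (he00 : e (x 0 0) = ξ1) (he01 : e (x 0 1) = 0)
    (he10 : e (x 1 0) = 0) (he11 : e (x 1 1) = ξ2)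
    (m : ℕ) (hnz : ∀ k : ℕ, k < m → ξ1 - q ^ (2 * k) * ξ2 ≠ 0)
    (hz : ξ1 - q ^ (2 * m) * ξ2 = 0) :
    LinearMap.range (coorbit e (adjBeta ΔM ι St))
        = Submodule.span ℂ {y : G | ∃ l : List G,
        (∀ z ∈ l, z = ι (x 0 0) * ι (x 1 0) * dInv ∨ z = ι (x 0 1) * ι (x 1 0) * dInv ∨
          z = ι (x 0 1) * ι (x 1 1) * dInv) ∧ l.length ≤ m ∧ y = l.prod}
    ∧ FiniteDimensional ℂ ↥(LinearMap.range (coorbit e (adjBeta ΔM ι St))) := by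
  have hextG : ∀ (B : Type) [Ring B] [Algebra ℂ B] (f g : G →ₐ[ℂ] B),
      (∀ i j, f (ι (x i j)) = g (ι (x i j))) → f = g := by
    intro B _ _ f g hfg
    have hι : f.comp ι = g.comp ι := by
      refine AlgHom.ext_of_adjoin_eq_top hgen ?_
      rintro _ ⟨p, rfl⟩
      exact hfg p.1 p.2
    obtain ⟨ψ, -, hψ⟩ := hfreeG B (f.comp ι) (f dInv)
      (by rw [AlgHom.comp_apply, ← map_mul, hd1, map_one])
      (by rw [AlgHom.comp_apply, ← map_mul, hd2, map_one])
    rw [hψ f rfl, hψ g hι.symm]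
  have hΔ : ∀ i j, ΔG (ι (x i j)) = ∑ k, ι (x i k) ⊗ₜ[ℂ] ι (x k j) := by
    intro i j
    simp [hΔG, hΔM]
  have hSt : ∀ g h, St (g * h) = St h * St g := by
    refine antipode_mul_of_convolution_inverse ΔG εG St (hextG _ _ _ fun i j => ?_)
      (hextG _ _ _ fun i j => ?_) (hextG _ _ _ fun i j => ?_) hS1 hS2
    · simp [hΔ, TensorProduct.add_tmul, TensorProduct.tmul_add]
      abel
    · simp [hΔ, hεG]
      fin_cases i <;> simp
    · simp [hΔ, hεG]
      fin_cases j <;> simp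
  have hSt1 : St 1 = 1 := by
    have := LinearMap.congr_fun hS1 1
    simpa [Algebra.TensorProduct.one_def] using this
  have hdet : ι (qdet q x) = ι (x 0 0) * ι (x 1 1) - q • (ι (x 0 1) * ι (x 1 0)) := by
    rw [qdet_fin_two, map_sub, map_smul, map_mul, map_mul]
  rw [hdet] at hd1 hd2
  have hG : QuantumGL2 q (ι (x 0 0)) (ι (x 0 1)) (ι (x 1 0)) (ι (x 1 1)) dInv := by
    refine .of_mul_qdet hq ?_ ?_ ?_ ?_ ?_ ?_ hd1 hd2
    · simpa using congrArg ι (hrow 0 0 1 (by decide))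
    · simpa using congrArg ι (hcol 0 1 0 (by decide))
    · simpa using congrArg ι (hanti 0 1 0 1 (by decide) (by decide))
    · simpa using congrArg ι (hcol 0 1 1 (by decide))
    · simpa using congrArg ι (hrow 1 0 1 (by decide))
    · simpa using congrArg ι (hdiag 0 1 0 1 (by decide) (by decide))
  have hSmat : (Matrix.of fun i j => St (ι (x i j))) =
      !![ι (x 1 1) * dInv, -(q⁻¹ • (ι (x 0 1) * dInv));
        -(q • (ι (x 1 0) * dInv)), ι (x 0 0) * dInv] := by
    refine left_inv_eq_right_inv (a := Matrix.of fun i j => ι (x i j)) ?_ ?_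
    · ext i j
      have := LinearMap.congr_fun hS1 (ι (x i j))
      simp only [LinearMap.comp_apply, AlgHom.toLinearMap_apply, hΔ, map_sum,
        TensorProduct.map_tmul, LinearMap.mul'_apply, LinearMap.id_apply, hεG,
        Algebra.linearMap_apply] at this
      rw [Matrix.mul_apply, Matrix.one_apply]
      simp only [Matrix.of_apply, this]
      split_ifs <;> simp
    · ext i j
      fin_cases i <;> fin_cases j <;>
        simp [Matrix.mul_apply, Fin.sum_univ_two, hG.adu, hG.dau]
      · rw [mul_mul_of_mul_eq_smul hG.ab, smul_smul, inv_mul_cancel₀ hq, one_smul, neg_add_cancel]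
      · rw [mul_mul_of_mul_eq_smul hG.dc, smul_smul, mul_inv_cancel₀ hq, one_smul, add_neg_cancel]
      · rw [hG.mul_left_cb]
        abel
  have hS : ∀ i j, St (ι (x i j)) = _ := fun i j => congrFun₂ hSmat i j
  have hact : ∀ h,
      coorbit e (adjBeta ΔM ι St) (h * x 0 0) =
        QuantumGL2.diagAct q ξ1 ξ2 (ι (x 0 0)) (ι (x 0 1)) (ι (x 1 0)) (ι (x 1 1)) dInv
          (coorbit e (adjBeta ΔM ι St) h) ∧
      coorbit e (adjBeta ΔM ι St) (h * x 0 1) =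
        QuantumGL2.offAct q ξ1 ξ2 (ι (x 0 1)) (ι (x 1 1)) dInv
          (coorbit e (adjBeta ΔM ι St) h) ∧
      coorbit e (adjBeta ΔM ι St) (h * x 1 0) =
        QuantumGL2.offAct q⁻¹ ξ2 ξ1 (ι (x 1 0)) (ι (x 0 0)) dInv
          (coorbit e (adjBeta ΔM ι St) h) ∧
      coorbit e (adjBeta ΔM ι St) (h * x 1 1) =
        QuantumGL2.diagAct q⁻¹ ξ2 ξ1 (ι (x 1 1)) (ι (x 1 0)) (ι (x 0 1)) (ι (x 0 0)) dInv
          (coorbit e (adjBeta ΔM ι St) h) := by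
    intro h
    simp only [coorbit_adjBeta_mul hΔM hSt, Fin.sum_univ_two, he00, he01, he10, he11, hS,
      QuantumGL2.diagAct, QuantumGL2.offAct, Matrix.cons_val_zero, Matrix.cons_val_one,
      Matrix.of_apply, LinearMap.sub_apply, LinearMap.smul_apply, LinearMap.mulLeftRight_apply,
      neg_mul, smul_mul_assoc, smul_neg, smul_smul,
      inv_inv]
    refine ⟨?_, ?_, ?_, ?_⟩ <;> module
  have h1 := coorbit_adjBeta_one (ΔM := ΔM) (ι := ι) hSt1 e
  have hrange : LinearMap.range (coorbit e (adjBeta ΔM ι St)) =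
      QuantumGL2.monomialSpan (ι (x 0 0)) (ι (x 0 1)) (ι (x 1 0)) (ι (x 1 1)) dInv m := by
    apply le_antisymm
    · refine range_le_of_mul_closed hgen _ (h1 ▸ QuantumGL2.one_mem_monomialSpan m) ?_
      rintro h hh _ ⟨⟨i, j⟩, rfl⟩
      obtain ⟨h00, h01, h10, h11⟩ := hG.actStable_monomialSpan hz hh
      obtain ⟨e00, e01, e10, e11⟩ := hact h
      fin_cases i <;> fin_cases j
      exacts [e00 ▸ h00, e01 ▸ h01, e10 ▸ h10, e11 ▸ h11]
    · refine hG.monomialSpan_le_of_actStable hnz ⟨1, h1⟩ ?_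
      rintro _ ⟨h, rfl⟩
      obtain ⟨e00, e01, e10, e11⟩ := hact h
      exact ⟨⟨_, e00⟩, ⟨_, e01⟩, ⟨_, e10⟩, ⟨_, e11⟩⟩
  rw [hrange]
  exact ⟨hG.monomialSpan_eq_span_prod m, inferInstance⟩
end
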